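/- Let U be the constant graphon U(x,y) = 1/2 and let W be the graphon W(x,y) = 1_{x ∈ [0,1/2]} · 1_{y ∈ [0,1/2]}. If U' and W' are {0,1}-valued graphons with δ_□(U, U') < 1/8 and δ_□(W, W') < 1/8, then U' and W' are not cospectral; that is, there exists an integer k ≥ 3 with t(C_k, U') ≠ t(C_k, W'). -/

import Mathlib

open MeasureTheory Set

noncomputable section

/-- Lebesgue measure restricted to `[0,1]`. -/
def μ01 : Measure ℝ := volume.restrict (Icc 0 1)

instance : IsFiniteMeasure μ01 := by
  constructor
  rw [μ01, Measure.restrict_apply_univ]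
  simp [Real.volume_Icc]

/-- A graphon: symmetric measurable `[0,1]`-valued kernel. -/
def IsGraphon (W : ℝ → ℝ → ℝ) : Prop :=
  Measurable (Function.uncurry W) ∧ (∀ x y, W x y = W y x) ∧ ∀ x y, W x y ∈ Icc (0:ℝ) 1

/-- Density `t(C_k, W)` of the `k`-cycle. -/
def cycleDensity (W : ℝ → ℝ → ℝ) (k : ℕ) : ℝ :=
  ∫ x : Fin k → ℝ in univ.pi fun _ => Icc (0:ℝ) 1, ∏ i, W (x i) (x (finRotate k i))

/-- The integral operator associated with a kernel `W`. -/
def TW (W : ℝ → ℝ → ℝ) (f : ℝ → ℝ) : ℝ → ℝ := fun x => ∫ y, W x y * f y ∂μ01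

/-- The `λ`-eigenspace (as a set of `L²` elements) of `T_W`. -/
def eigSet (W : ℝ → ℝ → ℝ) (lam : ℝ) : Set (Lp ℝ 2 μ01) :=
  {f | TW W ⇑f =ᵐ[μ01] fun x => lam * f x}

/-- Dimension of the `λ`-eigenspace of `T_W` (for a graphon `W` the eigenspace is a
linear subspace, hence equal to its span). -/
def eigRank (W : ℝ → ℝ → ℝ) (lam : ℝ) : Cardinal :=
  Module.rank ℝ (Submodule.span ℝ (eigSet W lam))

/-- The cut norm distance `d_□`. -/
def cutNormDist (U W : ℝ → ℝ → ℝ) : ℝ :=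
  sSup {d | ∃ S T : Set ℝ, MeasurableSet S ∧ MeasurableSet T ∧
    d = |∫ p in S ×ˢ T, (U p.1 p.2 - W p.1 p.2) ∂(μ01.prod μ01)|}

/-- A measure-preserving bijection of `[0,1]`. -/
def IsMPBij (φ : ℝ → ℝ) : Prop :=
  BijOn φ (Icc 0 1) (Icc 0 1) ∧ MeasurePreserving φ μ01 μ01

/-- The cut distance `δ_□`. -/
def cutDist (U W : ℝ → ℝ → ℝ) : ℝ :=
  sInf {d | ∃ φ : ℝ → ℝ, IsMPBij φ ∧ d = cutNormDist (fun x y => U (φ x) (φ y)) W}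

/-- `L¹`-norm on `[0,1]²`. -/
def L1norm (W : ℝ → ℝ → ℝ) : ℝ := ∫ p, |W p.1 p.2| ∂(μ01.prod μ01)

/-- Square of the `L²`-norm on `[0,1]²`. -/
def L2normSq (W : ℝ → ℝ → ℝ) : ℝ := ∫ p, (W p.1 p.2) ^ 2 ∂(μ01.prod μ01)

/-- A `{0,1}`-valued graphon. -/
def ZeroOneValued (W : ℝ → ℝ → ℝ) : Prop :=
  ∀ᵐ p ∂(μ01.prod μ01), W p.1 p.2 = 0 ∨ W p.1 p.2 = 1

/-- The constant graphon `U(x,y) = 1/2`. -/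
def Uhalf : ℝ → ℝ → ℝ := fun _ _ => 1 / 2

/-- The graphon `W(x,y) = 1_{x ∈ [0,1/2]} · 1_{y ∈ [0,1/2]}`. -/
def Wcorner : ℝ → ℝ → ℝ := fun x y =>
  (Icc (0:ℝ) (1/2)).indicator (fun _ => (1:ℝ)) x * (Icc (0:ℝ) (1/2)).indicator (fun _ => (1:ℝ)) y

section ContractionPowers

open Filter Topology

variable {H : Type*} [NormedAddCommGroup H] [InnerProductSpace ℝ H] {T : H →L[ℝ] H}

theorem norm_sq_one_sub_sq_apply_le (hs : ∀ x y, inner ℝ (T x) y = inner ℝ x (T y))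
    (hc : ∀ x, ‖T x‖ ≤ ‖x‖) (x : H) :
    ‖(1 - T ^ 2 : H →L[ℝ] H) x‖ ^ 2 ≤ ‖x‖ ^ 2 - ‖T x‖ ^ 2 := by
  have hA : (1 - T ^ 2 : H →L[ℝ] H) x = x - T (T x) := by simp [pow_two]
  have h1 := norm_sub_sq_real x (T (T x))
  rw [← hs, real_inner_self_eq_norm_sq] at h1
  have h2 : ‖T (T x)‖ ^ 2 ≤ ‖T x‖ ^ 2 := by gcongr; exact hc _
  rw [hA, h1]
  linarith

theorem norm_one_sub_sq_pow_apply_le (hs : ∀ x y, inner ℝ (T x) y = inner ℝ x (T y))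
    (hc : ∀ x, ‖T x‖ ≤ ‖x‖) (n : ℕ) (x : H) : ‖((1 - T ^ 2 : H →L[ℝ] H) ^ n) x‖ ≤ ‖x‖ := by
  induction n generalizing x with
  | zero => simp
  | succ n ih =>
    rw [pow_succ, ContinuousLinearMap.mul_def, ContinuousLinearMap.comp_apply]
    refine (ih _).trans (le_of_sq_le_sq ?_ (norm_nonneg _))
    have := norm_sq_one_sub_sq_apply_le hs hc x
    nlinarith [sq_nonneg ‖T x‖]

theorem tendsto_one_sub_sq_pow_apply_range (hs : ∀ x y, inner ℝ (T x) y = inner ℝ x (T y))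
    (hc : ∀ x, ‖T x‖ ≤ ‖x‖) (g : H) :
    Tendsto (fun n => ((1 - T ^ 2 : H →L[ℝ] H) ^ n) (T g)) atTop (𝓝 0) := by
  have step (n : ℕ) : ‖((1 - T ^ 2 : H →L[ℝ] H) ^ n) (T g)‖ ^ 2 ≤
      ‖((1 - T ^ 2 : H →L[ℝ] H) ^ n) g‖ ^ 2 - ‖((1 - T ^ 2 : H →L[ℝ] H) ^ (n + 1)) g‖ ^ 2 := by
    have hcomm : Commute ((1 - T ^ 2 : H →L[ℝ] H) ^ n) T :=
      ((Commute.one_left T).sub_left (Commute.pow_self T 2)).pow_left n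
    have h1 : ((1 - T ^ 2 : H →L[ℝ] H) ^ n) (T g) = T (((1 - T ^ 2 : H →L[ℝ] H) ^ n) g) :=
      congrArg (fun S : H →L[ℝ] H => S g) hcomm.eq
    have h2 := norm_sq_one_sub_sq_apply_le hs hc (((1 - T ^ 2 : H →L[ℝ] H) ^ n) g)
    rw [h1, pow_succ' (1 - T ^ 2 : H →L[ℝ] H), ContinuousLinearMap.mul_def, ContinuousLinearMap.comp_apply]
    linarith
  have hanti : Antitone fun n => ‖((1 - T ^ 2 : H →L[ℝ] H) ^ n) g‖ ^ 2 :=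
    antitone_nat_of_succ_le fun n => by
      have := step n
      nlinarith [sq_nonneg ‖((1 - T ^ 2 : H →L[ℝ] H) ^ n) (T g)‖]
  have hlim := tendsto_atTop_ciInf hanti ⟨0, by rintro _ ⟨n, rfl⟩; positivity⟩
  have hdiff := hlim.sub (hlim.comp (tendsto_add_atTop_nat 1))
  rw [sub_self] at hdiff
  have hsq := squeeze_zero (fun n => sq_nonneg ‖((1 - T ^ 2 : H →L[ℝ] H) ^ n) (T g)‖) step hdiff
  rw [tendsto_zero_iff_norm_tendsto_zero]
  simpa using hsq.sqrt

theorem tendsto_one_sub_sq_pow_apply [CompleteSpace H]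
    (hs : ∀ x y, inner ℝ (T x) y = inner ℝ x (T y))
    (hc : ∀ x, ‖T x‖ ≤ ‖x‖) {x : H} (hx : ∀ g, T g = 0 → inner ℝ x g = 0) :
    Tendsto (fun n => ((1 - T ^ 2 : H →L[ℝ] H) ^ n) x) atTop (𝓝 0) := by
  have hadj : ContinuousLinearMap.adjoint T = T :=
    (ContinuousLinearMap.isSelfAdjoint_iff_isSymmetric.mpr hs)
  have hmem : x ∈ (T.range.topologicalClosure : Submodule ℝ H) := by
    have := ContinuousLinearMap.orthogonal_ker T
    rw [hadj] at this
    rw [← this, Submodule.mem_orthogonal']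
    exact fun g hg => hx g hg
  rw [Metric.tendsto_atTop]
  intro ε hε
  obtain ⟨_, ⟨g, rfl⟩, hg⟩ := Metric.mem_closure_iff.mp hmem (ε / 2) (half_pos hε)
  obtain ⟨N, hN⟩ := Metric.tendsto_atTop.mp (tendsto_one_sub_sq_pow_apply_range hs hc g)
    (ε / 2) (half_pos hε)
  refine ⟨N, fun n hn => ?_⟩
  have h1 := hN n hn
  have h2 := norm_one_sub_sq_pow_apply_le hs hc n (x - T g)
  rw [dist_eq_norm] at hg
  rw [dist_zero_right] at h1 ⊢
  have h3 : ((1 - T ^ 2 : H →L[ℝ] H) ^ n) x = ((1 - T ^ 2 : H →L[ℝ] H) ^ n) (x - T g) + ((1 - T ^ 2 : H →L[ℝ] H) ^ n) (T g) := by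
    rw [← map_add, sub_add_cancel]
  have h4 := norm_add_le (((1 - T ^ 2 : H →L[ℝ] H) ^ n) (x - T g)) (((1 - T ^ 2 : H →L[ℝ] H) ^ n) (T g))
  rw [← h3] at h4
  have h5 : ‖x - T g‖ < ε / 2 := hg
  linarith

end ContractionPowers

instance : IsProbabilityMeasure μ01 := ⟨by simp [μ01]⟩

/-- A jointly measurable kernel with values in `[-1,1]`. -/
structure IsBoundedKernel (g : ℝ → ℝ → ℝ) : Prop where
  measurable : Measurable (Function.uncurry g)
  abs_le : ∀ x y, |g x y| ≤ 1

namespace IsBoundedKernel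

variable {g h : ℝ → ℝ → ℝ}

theorem measurable_left (hg : IsBoundedKernel g) (y : ℝ) : Measurable fun x => g x y :=
  hg.measurable.comp (measurable_id.prodMk measurable_const)

theorem memLp (hg : IsBoundedKernel g) (y : ℝ) : MemLp (fun x => g x y) 2 μ01 :=
  MemLp.of_bound (hg.measurable_left y).aestronglyMeasurable 1
    (Filter.Eventually.of_forall fun x => hg.abs_le x y)

theorem mul (hg : IsBoundedKernel g) (hh : IsBoundedKernel h) :
    IsBoundedKernel fun x y => g x y * h x y where
  measurable := hg.measurable.mul hh.measurable
  abs_le x y := by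
    rw [abs_mul]; exact mul_le_one₀ (hg.abs_le x y) (abs_nonneg _) (hh.abs_le x y)

theorem integrable (hg : IsBoundedKernel g) : Integrable (Function.uncurry g) (μ01.prod μ01) :=
  Integrable.of_bound hg.measurable.aestronglyMeasurable 1
    (Filter.Eventually.of_forall fun p => hg.abs_le p.1 p.2)

/-- The section `g(·, y)` as an element of `L²`. -/
def sec (hg : IsBoundedKernel g) (y : ℝ) : Lp ℝ 2 μ01 := (hg.memLp y).toLp

theorem coeFn_sec (hg : IsBoundedKernel g) (y : ℝ) : hg.sec y =ᵐ[μ01] fun x => g x y :=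
  (hg.memLp y).coeFn_toLp

theorem norm_sec_le (hg : IsBoundedKernel g) (y : ℝ) : ‖hg.sec y‖ ≤ 1 := by
  have h := Lp.norm_le_of_ae_bound (f := hg.sec y) zero_le_one (by
    filter_upwards [hg.coeFn_sec y] with x hx
    rw [hx]; exact hg.abs_le x y)
  simpa [measureUnivNNReal] using h

theorem inner_sec (hg : IsBoundedKernel g) (y : ℝ) (f : Lp ℝ 2 μ01) :
    inner ℝ (hg.sec y) f = ∫ x, g x y * f x ∂μ01 := by
  rw [L2.inner_def]
  refine integral_congr_ae ?_
  filter_upwards [hg.coeFn_sec y] with x hx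
  rw [hx]; simp [mul_comm]

theorem inner_sec_sec (hg : IsBoundedKernel g) (hh : IsBoundedKernel h) (y : ℝ) :
    inner ℝ (hg.sec y) (hh.sec y) = ∫ x, g x y * h x y ∂μ01 := by
  rw [inner_sec]
  refine integral_congr_ae ?_
  filter_upwards [hh.coeFn_sec y] with x hx
  rw [hx]

end IsBoundedKernel

/-- Composition of the kernel `W` with the kernel `g`. -/
def kerComp (W g : ℝ → ℝ → ℝ) : ℝ → ℝ → ℝ := fun x y => TW W (fun s => g s y) x

namespace IsGraphon

variable {W g : ℝ → ℝ → ℝ}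

theorem isBoundedKernel (hW : IsGraphon W) : IsBoundedKernel W where
  measurable := hW.1
  abs_le x y := abs_le.mpr ⟨by linarith [(hW.2.2 x y).1], (hW.2.2 x y).2⟩

theorem isBoundedKernel_kerComp (hW : IsGraphon W) (hg : IsBoundedKernel g) :
    IsBoundedKernel (kerComp W g) where
  measurable := by
    have h : Measurable fun q : (ℝ × ℝ) × ℝ => W q.1.1 q.2 * g q.2 q.1.2 :=
      (hW.1.comp ((measurable_fst.comp measurable_fst).prodMk measurable_snd)).mul
        (hg.measurable.comp (measurable_snd.prodMk (measurable_snd.comp measurable_fst)))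
    exact (StronglyMeasurable.integral_prod_right (ν := μ01)
      (f := fun (p : ℝ × ℝ) s => W p.1 s * g s p.2) h.stronglyMeasurable).measurable
  abs_le x y := by
    have h := norm_integral_le_of_norm_le_const (μ := μ01) (C := 1)
      (f := fun s => W x s * g s y) (Filter.Eventually.of_forall fun s => by
        rw [norm_mul]
        exact mul_le_one₀ (hW.isBoundedKernel.abs_le x s) (norm_nonneg _) (hg.abs_le s y))
    simpa [kerComp, TW] using h

theorem isBoundedKernel_iterate (hW : IsGraphon W) (hg : IsBoundedKernel g) (n : ℕ) :
    IsBoundedKernel ((kerComp W)^[n] g) := by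
  induction n with
  | zero => exact hg
  | succ n ih =>
    rw [Function.iterate_succ_apply']
    exact hW.isBoundedKernel_kerComp ih

theorem TW_apply (hW : IsGraphon W) (f : Lp ℝ 2 μ01) (x : ℝ) :
    TW W f x = inner ℝ (hW.isBoundedKernel.sec x) f := by
  rw [hW.isBoundedKernel.inner_sec]
  simp only [TW, hW.2.1 x]

theorem memLp_TW (hW : IsGraphon W) (f : Lp ℝ 2 μ01) : MemLp (TW W f) 2 μ01 := by
  have hm : StronglyMeasurable (TW W f) := by
    refine StronglyMeasurable.integral_prod_right (ν := μ01) (f := fun x s => W x s * f s) ?_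
    exact hW.1.stronglyMeasurable.mul
      ((Lp.stronglyMeasurable f).comp_measurable measurable_snd)
  refine MemLp.of_bound hm.aestronglyMeasurable ‖f‖ (Filter.Eventually.of_forall fun x => ?_)
  rw [hW.TW_apply]
  refine (norm_inner_le_norm _ _).trans ?_
  exact mul_le_of_le_one_left (norm_nonneg _) (hW.isBoundedKernel.norm_sec_le x)

/-- The integral operator of a graphon on `L²`. -/
def op (hW : IsGraphon W) : Lp ℝ 2 μ01 →L[ℝ] Lp ℝ 2 μ01 :=
  LinearMap.mkContinuous
    { toFun := fun f => (hW.memLp_TW f).toLp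
      map_add' := fun f₁ f₂ => by
        rw [← MemLp.toLp_add]
        congr 1
        ext x
        simp only [Pi.add_apply, hW.TW_apply, inner_add_right]
      map_smul' := fun c f => by
        rw [RingHom.id_apply, ← MemLp.toLp_const_smul]
        congr 1
        ext x
        simp [hW.TW_apply, inner_smul_right] }
    1 fun f => by
      have h := Lp.norm_le_of_ae_bound (f := (hW.memLp_TW f).toLp) (norm_nonneg f) (by
        filter_upwards [(hW.memLp_TW f).coeFn_toLp] with x hx
        rw [hx, hW.TW_apply]
        refine (norm_inner_le_norm _ _).trans ?_
        exact mul_le_of_le_one_left (norm_nonneg _) (hW.isBoundedKernel.norm_sec_le x))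
      simpa [measureUnivNNReal] using h

theorem coeFn_op (hW : IsGraphon W) (f : Lp ℝ 2 μ01) : hW.op f =ᵐ[μ01] TW W f :=
  (hW.memLp_TW f).coeFn_toLp

theorem norm_op_apply_le (hW : IsGraphon W) (f : Lp ℝ 2 μ01) : ‖hW.op f‖ ≤ ‖f‖ := by
  have h := hW.op.le_of_opNorm_le (LinearMap.mkContinuous_norm_le _ zero_le_one _) f
  simpa using h

theorem inner_op_left (hW : IsGraphon W) (f g : Lp ℝ 2 μ01) :
    inner ℝ (hW.op f) g = inner ℝ f (hW.op g) := by
  have hint : ∀ f : Lp ℝ 2 μ01, Integrable f μ01 := fun f => (Lp.memLp f).integrable one_le_two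
  have hfg : Integrable (Function.uncurry fun x y => W x y * (g x * f y)) (μ01.prod μ01) :=
    ((hint g).mul_prod (hint f)).bdd_mul (c := 1) hW.1.aestronglyMeasurable
      (Filter.Eventually.of_forall fun p => hW.isBoundedKernel.abs_le p.1 p.2)
  rw [L2.inner_def, L2.inner_def]
  calc _ = ∫ x, ∫ y, W x y * (g x * f y) ∂μ01 ∂μ01 := by
        refine integral_congr_ae ?_
        filter_upwards [hW.coeFn_op f] with x hx
        rw [hx]
        simp only [TW, RCLike.inner_apply, conj_trivial]
        rw [← integral_const_mul]
        congr 1; ext y; ring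
    _ = ∫ y, ∫ x, W x y * (g x * f y) ∂μ01 ∂μ01 := integral_integral_swap hfg
    _ = _ := by
        refine integral_congr_ae ?_
        filter_upwards [hW.coeFn_op g] with y hy
        rw [hy]
        simp only [TW, RCLike.inner_apply, conj_trivial]
        rw [← integral_mul_const]
        congr 1; ext x; rw [hW.2.1 x y]; ring

theorem op_sec (hW : IsGraphon W) (hg : IsBoundedKernel g) (y : ℝ) :
    hW.op (hg.sec y) = (hW.isBoundedKernel_kerComp hg).sec y := by
  refine Lp.ext ?_
  filter_upwards [hW.coeFn_op (hg.sec y), (hW.isBoundedKernel_kerComp hg).coeFn_sec y]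
    with x hx hx'
  rw [hx, hx']
  refine integral_congr_ae ?_
  filter_upwards [hg.coeFn_sec y] with s hs'
  rw [hs']

theorem op_pow_sec (hW : IsGraphon W) (n : ℕ) (y : ℝ) :
    (hW.op ^ n) (hW.isBoundedKernel.sec y) =
      (hW.isBoundedKernel_iterate hW.isBoundedKernel n).sec y := by
  induction n with
  | zero => rfl
  | succ n ih =>
    rw [pow_succ', ContinuousLinearMap.mul_def, ContinuousLinearMap.comp_apply, ih, op_sec]
    simp only [Function.iterate_succ_apply']

theorem ae_inner_sec_eq_zero (hW : IsGraphon W) :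
    ∀ᵐ y ∂μ01, ∀ f, hW.op f = 0 → inner ℝ (hW.isBoundedKernel.sec y) f = 0 := by
  have : Fact ((2 : ENNReal) ≠ ⊤) := ⟨by norm_num⟩
  have : SecondCountableTopology (Lp ℝ 2 μ01) := inferInstance
  have key : ∀ n, ∀ᵐ y ∂μ01, inner ℝ (hW.isBoundedKernel.sec y)
      (TopologicalSpace.denseSeq hW.op.ker n : Lp ℝ 2 μ01) = 0 := fun n => by
    have h0 : hW.op (TopologicalSpace.denseSeq hW.op.ker n : Lp ℝ 2 μ01) = 0 :=
      (TopologicalSpace.denseSeq hW.op.ker n).2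
    filter_upwards [hW.coeFn_op (TopologicalSpace.denseSeq hW.op.ker n : Lp ℝ 2 μ01),
      Lp.coeFn_zero ℝ 2 μ01] with y hy hy0
    rw [← hW.TW_apply, ← hy, h0, hy0]
    rfl
  filter_upwards [ae_all_iff.mpr key] with y hy f hf
  have hclosed : IsClosed {v : hW.op.ker |
      inner ℝ (hW.isBoundedKernel.sec y) (v : Lp ℝ 2 μ01) = 0} :=
    isClosed_eq (by fun_prop) continuous_const
  exact (TopologicalSpace.denseRange_denseSeq hW.op.ker).induction_on
    (p := fun v => inner ℝ (hW.isBoundedKernel.sec y) (v : Lp ℝ 2 μ01) = 0)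
    (⟨f, hf⟩ : hW.op.ker) hclosed hy

/-- The quantity `∫ ⟨W(·,y), T_Wⁿ W(·,y)⟩ dy`, which is `t(C_{n+2}, W)` for `n ≥ 1`. -/
def moment (hW : IsGraphon W) (n : ℕ) : ℝ :=
  ∫ y, inner ℝ (hW.isBoundedKernel.sec y) ((hW.op ^ n) (hW.isBoundedKernel.sec y)) ∂μ01

theorem integrable_moment (hW : IsGraphon W) (n : ℕ) :
    Integrable (fun y => inner ℝ (hW.isBoundedKernel.sec y)
      ((hW.op ^ n) (hW.isBoundedKernel.sec y))) μ01 := by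
  simp only [op_pow_sec, IsBoundedKernel.inner_sec_sec]
  exact (hW.isBoundedKernel.mul
    (hW.isBoundedKernel_iterate hW.isBoundedKernel n)).integrable.integral_prod_right

theorem integrable_aeval (hW : IsGraphon W) (p : Polynomial ℝ) :
    Integrable (fun y => inner ℝ (hW.isBoundedKernel.sec y)
      ((Polynomial.aeval hW.op p) (hW.isBoundedKernel.sec y))) μ01 := by
  simp only [Polynomial.aeval_eq_sum_range, sum_apply, inner_sum,
    smul_apply, inner_smul_right]
  exact integrable_finsetSum _ fun i _ => (hW.integrable_moment i).const_mul _

theorem integral_aeval (hW : IsGraphon W) (p : Polynomial ℝ) :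
    ∫ y, inner ℝ (hW.isBoundedKernel.sec y)
      ((Polynomial.aeval hW.op p) (hW.isBoundedKernel.sec y)) ∂μ01 =
      ∑ i ∈ Finset.range (p.natDegree + 1), p.coeff i * hW.moment i := by
  simp only [Polynomial.aeval_eq_sum_range, sum_apply, inner_sum,
    smul_apply, inner_smul_right]
  rw [integral_finsetSum _ fun i _ => (hW.integrable_moment i).const_mul _]
  simp only [integral_const_mul, moment]

theorem tendsto_integral_aeval (hW : IsGraphon W) :
    Filter.Tendsto (fun n : ℕ => ∫ y, inner ℝ (hW.isBoundedKernel.sec y)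
      ((Polynomial.aeval hW.op ((1 - Polynomial.X ^ 2) ^ n : Polynomial ℝ))
        (hW.isBoundedKernel.sec y)) ∂μ01) Filter.atTop (nhds 0) := by
  have h := tendsto_integral_of_dominated_convergence (μ := μ01) (f := fun _ => (0 : ℝ))
    (F := fun (n : ℕ) y => inner ℝ (hW.isBoundedKernel.sec y)
      ((Polynomial.aeval hW.op ((1 - Polynomial.X ^ 2) ^ n : Polynomial ℝ))
        (hW.isBoundedKernel.sec y))) (fun _ => 1)
    (fun n => (hW.integrable_aeval _).aestronglyMeasurable) (integrable_const _)
    (fun n => Filter.Eventually.of_forall fun y => ?_) ?_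
  · simpa using h
  · refine (norm_inner_le_norm _ _).trans ?_
    have h1 := hW.isBoundedKernel.norm_sec_le y
    have h2 := norm_one_sub_sq_pow_apply_le hW.inner_op_left hW.norm_op_apply_le n
      (hW.isBoundedKernel.sec y)
    simp only [map_pow, map_sub, map_one, Polynomial.aeval_X]
    exact mul_le_one₀ h1 (norm_nonneg _) (h2.trans h1)
  · filter_upwards [hW.ae_inner_sec_eq_zero] with y hy
    have h2 := tendsto_one_sub_sq_pow_apply hW.inner_op_left hW.norm_op_apply_le hy
    simp only [map_pow, map_sub, map_one, Polynomial.aeval_X]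
    simpa using (tendsto_const_nhds (x := hW.isBoundedKernel.sec y)).inner h2

theorem moment_zero_eq {U : ℝ → ℝ → ℝ} (hU : IsGraphon U) (hW : IsGraphon W)
    (h : ∀ n, hU.moment (n + 1) = hW.moment (n + 1)) : hU.moment 0 = hW.moment 0 := by
  have hlim := hU.tendsto_integral_aeval.sub hW.tendsto_integral_aeval
  have hconst : ∀ n : ℕ, (∑ i ∈ Finset.range (((1 - Polynomial.X ^ 2) ^ n :
        Polynomial ℝ).natDegree + 1),
        ((1 - Polynomial.X ^ 2) ^ n : Polynomial ℝ).coeff i * hU.moment i) -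
      ∑ i ∈ Finset.range (((1 - Polynomial.X ^ 2) ^ n : Polynomial ℝ).natDegree + 1),
        ((1 - Polynomial.X ^ 2) ^ n : Polynomial ℝ).coeff i * hW.moment i =
      hU.moment 0 - hW.moment 0 := fun n => by
    rw [Finset.sum_range_succ', Finset.sum_range_succ']
    simp only [h]
    have h0 : ((1 - Polynomial.X ^ 2) ^ n : Polynomial ℝ).coeff 0 = 1 := by
      rw [Polynomial.coeff_zero_eq_eval_zero]; simp
    rw [h0]; ring
  simp only [integral_aeval, hconst, sub_zero] at hlim
  exact sub_eq_zero.mp (tendsto_nhds_unique tendsto_const_nhds hlim)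

end IsGraphon

namespace IsGraphon

variable {W g : ℝ → ℝ → ℝ}

theorem abs_prod_le_one (hW : IsGraphon W) {n : ℕ} (a b : Fin n → ℝ) :
    |∏ i, W (a i) (b i)| ≤ 1 := by
  rw [Finset.abs_prod]
  exact Finset.prod_le_one (fun i _ => abs_nonneg _)
    fun i _ => hW.isBoundedKernel.abs_le (a i) (b i)

theorem integral_path (hW : IsGraphon W) (n : ℕ) (hg : IsBoundedKernel g) :
    ∫ x : Fin (n + 1) → ℝ, (∏ i : Fin n, W (x i.castSucc) (x i.succ)) * g (x 0) (x (Fin.last n))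
      ∂Measure.pi (fun _ => μ01) = ∫ x, ((kerComp W)^[n] g) x x ∂μ01 := by
  induction n generalizing g with
  | zero =>
    have h := (measurePreserving_funUnique μ01 (Fin 1)).integral_comp' fun x => g x x
    simp only [Finset.univ_eq_empty, Finset.prod_empty, one_mul, Function.iterate_zero, id_eq]
    convert h using 2
    · congr 1
    · rfl
  | succ n ih =>
    rw [Function.iterate_succ_apply, ← ih (hW.isBoundedKernel_kerComp hg)]
    let F : ℝ → (Fin (n + 1) → ℝ) → ℝ := fun s x =>
      (W s (x 0) * ∏ i : Fin n, W (x i.castSucc) (x i.succ)) * g s (x (Fin.last n))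
    have hF : Measurable (Function.uncurry F) := by
      refine Measurable.mul (Measurable.mul ?_ ?_) ?_
      · exact hW.1.comp (measurable_fst.prodMk ((measurable_pi_apply 0).comp measurable_snd))
      · refine Finset.measurable_fun_prod _ fun i _ => ?_
        have hi : Measurable fun p : ℝ × (Fin (n + 1) → ℝ) => (p.2 i.castSucc, p.2 i.succ) := by
          fun_prop
        exact hW.1.comp hi
      · exact hg.measurable.comp
          (measurable_fst.prodMk ((measurable_pi_apply _).comp measurable_snd))
    have hint : Integrable (Function.uncurry F) (μ01.prod (Measure.pi fun _ => μ01)) := by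
      refine Integrable.of_bound hF.aestronglyMeasurable 1 (Filter.Eventually.of_forall ?_)
      rintro ⟨s, x⟩
      simp only [Function.uncurry, F, norm_mul]
      exact mul_le_one₀ (mul_le_one₀ (hW.isBoundedKernel.abs_le _ _) (norm_nonneg _)
        (hW.abs_prod_le_one _ _)) (norm_nonneg _) (hg.abs_le _ _)
    calc _ = ∫ p, Function.uncurry F p ∂μ01.prod (Measure.pi fun _ => μ01) := by
          rw [← (measurePreserving_piFinSuccAbove (fun _ : Fin (n + 2) => μ01) 0).integral_comp'
            (Function.uncurry F)]
          refine integral_congr_ae (Filter.Eventually.of_forall fun x => ?_)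
          simp [F, Fin.prod_univ_succ, MeasurableEquiv.piFinSuccAbove, Fin.insertNthEquiv,
            Fin.tail]
      _ = ∫ x, ∫ s, F s x ∂μ01 ∂Measure.pi (fun _ => μ01) := integral_prod_symm _ hint
      _ = _ := by
          refine integral_congr_ae (Filter.Eventually.of_forall fun x => ?_)
          simp only [F, kerComp, TW]
          rw [← integral_const_mul]
          refine integral_congr_ae (Filter.Eventually.of_forall fun s => ?_)
          simp only [hW.2.1 s (x 0)]
          ring

theorem cycleDensity_eq_moment (hW : IsGraphon W) (n : ℕ) :
    cycleDensity W (n + 2) = hW.moment n := by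
  have hvol : (volume : Measure (Fin (n + 2) → ℝ)).restrict (univ.pi fun _ => Icc (0 : ℝ) 1) =
      Measure.pi fun _ => μ01 :=
    Measure.restrict_pi_pi (fun _ => volume) _
  have hpath := hW.integral_path (n + 1) hW.isBoundedKernel
  rw [cycleDensity, hvol]
  calc _ = ∫ x : Fin (n + 2) → ℝ, (∏ i : Fin (n + 1), W (x i.castSucc) (x i.succ)) *
        W (x 0) (x (Fin.last (n + 1))) ∂Measure.pi (fun _ => μ01) := by
        refine integral_congr_ae (Filter.Eventually.of_forall fun x => ?_)
        simp only [Fin.prod_univ_castSucc (n := n + 1), finRotate_last]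
        rw [hW.2.1 (x (Fin.last (n + 1)))]
        congr 1
        refine Finset.prod_congr rfl fun i _ => ?_
        have hi : finRotate (n + 2) i.castSucc = i.succ := finRotate_of_lt i.2
        rw [hi]
    _ = _ := hpath
    _ = _ := by
        simp only [moment, op_pow_sec, IsBoundedKernel.inner_sec_sec, Function.iterate_succ_apply']
        refine integral_congr_ae (Filter.Eventually.of_forall fun x => ?_)
        simp only [kerComp, TW, hW.2.1 x]

theorem moment_zero_eq_integral (hW : IsGraphon W) (h0 : ZeroOneValued W) :
    hW.moment 0 = ∫ p, W p.1 p.2 ∂μ01.prod μ01 := by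
  have h1 := integral_prod_symm _ (hW.isBoundedKernel.mul hW.isBoundedKernel).integrable
  simp only [moment, pow_zero, one_apply_eq_self, IsBoundedKernel.inner_sec_sec]
  refine h1.symm.trans (integral_congr_ae ?_)
  filter_upwards [h0] with p hp
  rcases hp with hp | hp <;> simp [Function.uncurry, hp]

theorem abs_integral_sub_lt_of_cutDist_lt {V : ℝ → ℝ → ℝ} {ε : ℝ} (hV : IsBoundedKernel V)
    (hW : IsGraphon W) (h : cutDist V W < ε) :
    |(∫ p, V p.1 p.2 ∂μ01.prod μ01) - ∫ p, W p.1 p.2 ∂μ01.prod μ01| < ε := by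
  obtain ⟨_, ⟨φ, hφ, rfl⟩, hlt⟩ := exists_lt_of_csInf_lt
    (show {d | ∃ φ : ℝ → ℝ, IsMPBij φ ∧ d = cutNormDist (fun x y => V (φ x) (φ y)) W}.Nonempty from
      ⟨_, id, ⟨bijOn_id _, MeasurePreserving.id _⟩, rfl⟩) h
  refine lt_of_le_of_lt ?_ hlt
  have hbdd : BddAbove {d | ∃ S T : Set ℝ, MeasurableSet S ∧ MeasurableSet T ∧
      d = |∫ p in S ×ˢ T, (V (φ p.1) (φ p.2) - W p.1 p.2) ∂(μ01.prod μ01)|} := by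
    refine ⟨2, ?_⟩
    rintro _ ⟨S, T, -, -, rfl⟩
    have hle := norm_setIntegral_le_of_norm_le_const (μ := μ01.prod μ01) (s := S ×ˢ T) (C := 2)
      (f := fun p : ℝ × ℝ => V (φ p.1) (φ p.2) - W p.1 p.2) (measure_lt_top _ _) fun p _ => by
        have h1 := hV.abs_le (φ p.1) (φ p.2)
        have h2 := hW.isBoundedKernel.abs_le p.1 p.2
        exact (abs_sub _ _).trans (by linarith)
    exact hle.trans (by linarith [measureReal_le_one (μ := μ01.prod μ01) (s := S ×ˢ T)])
  have hprod := hφ.2.prod hφ.2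
  have hVφ : ∫ p : ℝ × ℝ, V (φ p.1) (φ p.2) ∂μ01.prod μ01 = ∫ p, V p.1 p.2 ∂μ01.prod μ01 := by
    have h1 := integral_map (μ := μ01.prod μ01) (φ := Prod.map φ φ) hprod.measurable.aemeasurable
      (f := Function.uncurry V) hV.measurable.aestronglyMeasurable
    rw [hprod.map_eq] at h1
    exact h1.symm
  have hint : Integrable (fun p : ℝ × ℝ => V (φ p.1) (φ p.2)) (μ01.prod μ01) :=
    hprod.integrable_comp_of_integrable hV.integrable
  refine le_csSup hbdd ⟨univ, univ, MeasurableSet.univ, MeasurableSet.univ, ?_⟩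
  have hWint : Integrable (fun p : ℝ × ℝ => W p.1 p.2) (μ01.prod μ01) :=
    hW.isBoundedKernel.integrable
  rw [univ_prod_univ, setIntegral_univ, integral_sub hint hWint, hVφ]

end IsGraphon

theorem isBoundedKernel_Uhalf : IsBoundedKernel Uhalf where
  measurable := measurable_const
  abs_le x y := by simp only [Uhalf]; norm_num [abs_le]

theorem isBoundedKernel_Wcorner : IsBoundedKernel Wcorner where
  measurable := by
    have h : Measurable ((Icc (0 : ℝ) (1 / 2)).indicator fun _ => (1 : ℝ)) :=
      measurable_const.indicator measurableSet_Icc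
    exact (h.comp measurable_fst).mul (h.comp measurable_snd)
  abs_le x y := by
    simp only [Wcorner, indicator_apply]
    split_ifs <;> simp

theorem integral_Uhalf : ∫ p : ℝ × ℝ, Uhalf p.1 p.2 ∂μ01.prod μ01 = 1 / 2 := by
  simp [Uhalf]

theorem integral_Wcorner : ∫ p : ℝ × ℝ, Wcorner p.1 p.2 ∂μ01.prod μ01 = 1 / 4 := by
  have h : ∫ x, (Icc (0 : ℝ) (1 / 2)).indicator (fun _ => (1 : ℝ)) x ∂μ01 = 1 / 2 := by
    have hI : Icc (0 : ℝ) (1 / 2) ∩ Icc 0 1 = Icc 0 (1 / 2) :=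
      inter_eq_left.mpr (Icc_subset_Icc_right (by norm_num))
    rw [integral_indicator measurableSet_Icc, μ01, Measure.restrict_restrict measurableSet_Icc, hI]
    simp
  simp only [Wcorner]
  rw [integral_prod_mul, h]
  norm_num

/-- `{0,1}`-valued graphons within cut distance `1/8` of the constant-`1/2` graphon and
the corner graphon, respectively, are not cospectral. -/
theorem stmt9 (U' W' : ℝ → ℝ → ℝ) (hU' : IsGraphon U') (hW' : IsGraphon W')
    (h0U : ZeroOneValued U') (h0W : ZeroOneValued W')
    (hdU : cutDist Uhalf U' < 1/8) (hdW : cutDist Wcorner W' < 1/8) :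
    ∃ k : ℕ, 3 ≤ k ∧ cycleDensity U' k ≠ cycleDensity W' k := by
  by_contra! hcon
  have hmom := hU'.moment_zero_eq hW' fun n => by
    rw [← hU'.cycleDensity_eq_moment, ← hW'.cycleDensity_eq_moment]
    exact hcon _ (by omega)
  rw [hU'.moment_zero_eq_integral h0U, hW'.moment_zero_eq_integral h0W] at hmom
  have hU := hU'.abs_integral_sub_lt_of_cutDist_lt isBoundedKernel_Uhalf hdU
  have hW := hW'.abs_integral_sub_lt_of_cutDist_lt isBoundedKernel_Wcorner hdW
  rw [integral_Uhalf, abs_lt] at hU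
  rw [integral_Wcorner, abs_lt] at hW
  linarith [hU.2, hW.1]

end
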